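/- Let x be a complex number and α a complex number such that none of 2α, 2α−1, and α+1/2 is a nonpositive integer. Then ₁F₁(α; 2α; x) · ₁F₁(α; 2α−1; x) = e^x · [ ₁F₂(α; α+1/2, 2α−1; x²/4) + (x/(2(2α−1))) · ₁F₂(α; α+1/2, 2α; x²/4) ]. -/

import Mathlib

/-- Pochhammer symbol (rising factorial) `(c)_k = c (c+1) ⋯ (c+k-1)` for complex `c`. -/
noncomputable def poch (c : ℂ) (k : ℕ) : ℂ := ∏ l ∈ Finset.range k, (c + l)

/-- Generalized hypergeometric series `ₚF_q(a; b; x) = Σ_k (a₁)_k⋯(a_p)_k / ((b₁)_k⋯(b_q)_k) · x^k/k!`. -/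
noncomputable def pFq (a b : List ℂ) (x : ℂ) : ℂ :=
  ∑' k : ℕ, ((a.map (fun c => poch c k)).prod / (b.map (fun c => poch c k)).prod)
    * x ^ k / (Nat.factorial k)

/-- `c` is not a nonpositive integer, i.e. `c ≠ 0, -1, -2, …`. -/
def NotNonposInt (c : ℂ) : Prop := ∀ n : ℕ, c ≠ -(n : ℂ)

theorem poch_zero (c : ℂ) : poch c 0 = 1 := by simp [poch]

theorem poch_succ (c : ℂ) (n : ℕ) : poch c (n + 1) = poch c n * (c + n) :=
  Finset.prod_range_succ _ _

theorem NotNonposInt.add_natCast_ne_zero {c : ℂ} (hc : NotNonposInt c) (n : ℕ) : c + n ≠ 0 :=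
  fun h => hc n (eq_neg_of_add_eq_zero_left h)

theorem poch_ne_zero {c : ℂ} (hc : NotNonposInt c) (n : ℕ) : poch c n ≠ 0 :=
  Finset.prod_ne_zero_iff.2 fun l _ => hc.add_natCast_ne_zero l

/-- `(c)_n (c + n) = c (c + 1)_n` with `c = b - 1`. -/
theorem poch_sub_one_mul (b : ℂ) (n : ℕ) : poch (b - 1) n * (b - 1 + n) = (b - 1) * poch b n := by
  induction n with
  | zero => simp [poch_zero]
  | succ n ih =>
    rw [poch_succ, ih, poch_succ]
    push_cast
    ring

theorem pFq_one_one (a b x : ℂ) :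
    pFq [a] [b] x = ∑' k : ℕ, poch a k / poch b k * x ^ k / k.factorial := by
  simp [pFq]

theorem pFq_one_two (a b c x : ℂ) :
    pFq [a] [b, c] x = ∑' k : ℕ, poch a k / (poch b k * poch c k) * x ^ k / k.factorial := by
  simp [pFq]

section Summability

open Filter Topology

theorem tendsto_inv_add_natCast (b : ℂ) : Tendsto (fun n : ℕ => (b + n)⁻¹) atTop (𝓝 0) := by
  refine tendsto_inv₀_cobounded.comp ?_
  rw [← tendsto_norm_atTop_iff_cobounded]
  refine tendsto_atTop_mono (f := fun n : ℕ => (n : ℝ) - ‖b‖) (fun n => ?_)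
    (tendsto_atTop_add_const_right _ _ tendsto_natCast_atTop_atTop)
  have h := norm_sub_norm_le (n : ℂ) (-b)
  rw [norm_neg, sub_neg_eq_add, add_comm (n : ℂ), Complex.norm_natCast] at h
  exact h

theorem tendsto_add_natCast_div {b : ℂ} (a : ℂ) (hb : NotNonposInt b) :
    Tendsto (fun n : ℕ => (a + n) / (b + n)) atTop (𝓝 1) := by
  have h := ((tendsto_inv_add_natCast b).const_mul (a - b)).const_add 1
  rw [mul_zero, add_zero] at h
  refine h.congr fun n => ?_
  have := hb.add_natCast_ne_zero n
  field_simp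
  ring

theorem summable_norm_of_ratio_tendsto_zero {f r : ℕ → ℂ} (hf : ∀ n, f (n + 1) = r n * f n)
    (hr : Tendsto r atTop (𝓝 0)) : Summable fun n => ‖f n‖ := by
  refine summable_of_ratio_norm_eventually_le (r := 1 / 2) (by norm_num) ?_
  have h := hr.norm
  rw [norm_zero] at h
  filter_upwards [h.eventually (gt_mem_nhds (by norm_num : (0 : ℝ) < 1 / 2))] with n hn
  rw [hf, norm_norm, norm_norm, norm_mul]
  gcongr

theorem summable_norm_one_one (a x : ℂ) {b : ℂ} (hb : NotNonposInt b) :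
    Summable fun k : ℕ => ‖poch a k / poch b k * x ^ k / k.factorial‖ := by
  have h := ((tendsto_add_natCast_div a hb).mul (tendsto_inv_add_natCast 1)).mul_const x
  rw [mul_zero, zero_mul] at h
  refine summable_norm_of_ratio_tendsto_zero (fun n => ?_) h
  have := hb.add_natCast_ne_zero n
  have := poch_ne_zero hb n
  have : (1 + n : ℂ) ≠ 0 := by norm_cast; omega
  have : (n + 1 : ℂ) ≠ 0 := by norm_cast
  rw [poch_succ, poch_succ, Nat.factorial_succ]
  push_cast
  field_simp
  ring

theorem summable_norm_one_two (a x : ℂ) {b c : ℂ} (hb : NotNonposInt b) (hc : NotNonposInt c) :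
    Summable fun k : ℕ => ‖poch a k / (poch b k * poch c k) * x ^ k / k.factorial‖ := by
  have h := (((tendsto_add_natCast_div a hb).mul (tendsto_inv_add_natCast c)).mul
    (tendsto_inv_add_natCast 1)).mul_const x
  rw [mul_zero, zero_mul] at h
  refine summable_norm_of_ratio_tendsto_zero (fun n => ?_) h
  have := hb.add_natCast_ne_zero n
  have := hc.add_natCast_ne_zero n
  have := poch_ne_zero hb n
  have := poch_ne_zero hc n
  have : (1 + n : ℂ) ≠ 0 := by norm_cast; omega
  have : (n + 1 : ℂ) ≠ 0 := by norm_cast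
  rw [poch_succ, poch_succ, poch_succ, Nat.factorial_succ]
  push_cast
  field_simp
  ring

end Summability

namespace PowerSeries

theorem coeff_X_mul_derivative (P : ℂ⟦X⟧) (n : ℕ) :
    coeff n (X * d⁄dX ℂ P) = n * coeff n P := by
  cases n with
  | zero => simp
  | succ n =>
    rw [coeff_succ_X_mul, coeff_derivative]
    push_cast
    ring

/-- The value of a product of power series at a point of absolute convergence. -/
theorem tsum_coeff_mul {P Q : ℂ⟦X⟧} {x : ℂ} (hP : Summable fun n => ‖coeff n P * x ^ n‖)
    (hQ : Summable fun n => ‖coeff n Q * x ^ n‖) :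
    (∑' n, coeff n P * x ^ n) * (∑' n, coeff n Q * x ^ n) = ∑' n, coeff n (P * Q) * x ^ n := by
  rw [tsum_mul_tsum_eq_tsum_sum_antidiagonal_of_summable_norm hP hQ]
  refine tsum_congr fun n => ?_
  rw [coeff_mul, Finset.sum_mul]
  refine Finset.sum_congr rfl fun kl hkl => ?_
  rw [← Finset.HasAntidiagonal.mem_antidiagonal.1 hkl, pow_add]
  ring

/-- Coefficients of the even solution of `X u'' + 2 α u' = X u / 4` with `u(0) = 1`. -/
noncomputable def besselCoeff (α : ℂ) : ℕ → ℂ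
  | 0 => 1
  | 1 => 0
  | n + 2 => besselCoeff α n / (4 * (n + 2) * (2 * α + (n + 1 : ℕ)))

/-- The even solution of `X u'' + 2 α u' = X u / 4` with `u(0) = 1`. -/
noncomputable def besselSeries (α : ℂ) : ℂ⟦X⟧ := mk (besselCoeff α)

theorem coeff_besselSeries_odd (α : ℂ) (k : ℕ) : coeff (2 * k + 1) (besselSeries α) = 0 := by
  induction k with
  | zero => simp [besselSeries, besselCoeff]
  | succ k ih =>
    rw [besselSeries, coeff_mk] at ih ⊢
    rw [show 2 * (k + 1) + 1 = 2 * k + 1 + 2 by ring, besselCoeff, ih, zero_div]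

theorem besselSeries_ode {α : ℂ} (h : NotNonposInt (2 * α)) :
    X * d⁄dX ℂ (d⁄dX ℂ (besselSeries α)) + 2 * C α * d⁄dX ℂ (besselSeries α) =
      C (2⁻¹ : ℂ) ^ 2 * (X * besselSeries α) := by
  rw [show (2 * C α : ℂ⟦X⟧) = C (2 * α) by rw [map_mul, map_ofNat], ← map_pow]
  ext n
  rw [map_add, coeff_X_mul_derivative, coeff_C_mul, coeff_C_mul, coeff_derivative]
  cases n with
  | zero => simp [besselSeries, besselCoeff]
  | succ n =>
    rw [coeff_succ_X_mul, besselSeries, coeff_mk, coeff_mk, besselCoeff]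
    have := h.add_natCast_ne_zero (n + 1)
    have h2 : (n + 2 : ℂ) ≠ 0 := by norm_cast
    push_cast at this ⊢
    have h3 : α * 2 + n + 1 ≠ 0 := by convert this using 1; ring
    field_simp
    ring

/-- The exponential series `exp (X / 2)`. -/
noncomputable def expHalf : ℂ⟦X⟧ := rescale (2⁻¹ : ℂ) (exp ℂ)

theorem derivative_expHalf : d⁄dX ℂ expHalf = C (2⁻¹ : ℂ) * expHalf := by
  ext n
  rw [coeff_derivative, coeff_C_mul, expHalf, coeff_rescale, coeff_rescale, coeff_exp, coeff_exp,
    Nat.factorial_succ]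
  have : (n + 1 : ℂ) ≠ 0 := by norm_cast
  have : (n.factorial : ℂ) ≠ 0 := by exact_mod_cast n.factorial_ne_zero
  simp
  field_simp
  ring

theorem expHalf_sq : expHalf ^ 2 = exp ℂ := by
  rw [sq, expHalf, exp_mul_exp_eq_exp_add]
  norm_num

theorem two_mul_C_half : (2 : ℂ⟦X⟧) * C (2⁻¹ : ℂ) = 1 := by
  rw [show (2 : ℂ⟦X⟧) = C 2 from (map_ofNat C 2).symm, ← map_mul]
  simp

/-- Kummer's second formula: `exp (X / 2)` times the even series solves Kummer's equation. -/
theorem expHalf_mul_besselSeries_ode {α : ℂ} (h : NotNonposInt (2 * α)) :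
    X * d⁄dX ℂ (d⁄dX ℂ (expHalf * besselSeries α)) +
      (2 * C α) * d⁄dX ℂ (expHalf * besselSeries α) =
      X * d⁄dX ℂ (expHalf * besselSeries α) + C α * (expHalf * besselSeries α) := by
  have hU := besselSeries_ode h
  simp only [Derivation.leibniz, map_add, derivative_expHalf, derivative_C, smul_eq_mul]
  linear_combination expHalf * hU +
    (expHalf * X * d⁄dX ℂ (besselSeries α) + C α * expHalf * besselSeries α
      + X * C (2⁻¹ : ℂ) * expHalf * besselSeries α) * two_mul_C_half

theorem coeff_expHalf_mul_besselSeries {α : ℂ} (h : NotNonposInt (2 * α)) (n : ℕ) :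
    coeff n (expHalf * besselSeries α) = poch α n / poch (2 * α) n / n.factorial := by
  induction n with
  | zero =>
    simp [expHalf, besselSeries, besselCoeff, poch_zero, coeff_mul, coeff_rescale,
      -coeff_zero_eq_constantCoeff]
  | succ n ih =>
    have key := congrArg (coeff n) (expHalf_mul_besselSeries_ode h)
    rw [show (2 * C α : ℂ⟦X⟧) = C (2 * α) by rw [map_mul, map_ofNat], map_add, map_add,
      coeff_X_mul_derivative, coeff_X_mul_derivative, coeff_C_mul, coeff_C_mul, coeff_derivative, ih] at key
    have h1 := h.add_natCast_ne_zero n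
    have := poch_ne_zero h n
    have h2 : (n + 1 : ℂ) ≠ 0 := by norm_cast
    have : (n.factorial : ℂ) ≠ 0 := by exact_mod_cast n.factorial_ne_zero
    rw [poch_succ, poch_succ, Nat.factorial_succ]
    refine mul_left_cancel₀ (mul_ne_zero h1 h2) ?_
    push_cast
    trans (α + n) * (poch α n / poch (2 * α) n / n.factorial)
    · linear_combination key
    · generalize poch (2 * α) n = p at *
      generalize 2 * α + (n : ℂ) = q at *
      field_simp

theorem besselSeries_sq_ode {α : ℂ} (h : NotNonposInt (2 * α)) :
    X * (X * d⁄dX ℂ (d⁄dX ℂ (d⁄dX ℂ (besselSeries α ^ 2)))) +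
      6 * C α * (X * d⁄dX ℂ (d⁄dX ℂ (besselSeries α ^ 2))) +
      (8 * C α ^ 2 - 2 * C α) * d⁄dX ℂ (besselSeries α ^ 2) =
      X * (X * d⁄dX ℂ (besselSeries α ^ 2)) + 2 * C α * (X * besselSeries α ^ 2) := by
  have hU := besselSeries_ode h
  have hU' := congrArg (d⁄dX ℂ) hU
  have hC : 4 * C (2⁻¹ : ℂ) ^ 2 = (1 : ℂ⟦X⟧) := by
    linear_combination (2 * C (2⁻¹ : ℂ) + 1 : ℂ⟦X⟧) * two_mul_C_half
  have h2 : d⁄dX ℂ (2 : ℂ⟦X⟧) = 0 := by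
    rw [show (2 : ℂ⟦X⟧) = C 2 from (map_ofNat C 2).symm, derivative_C]
  simp only [pow_two, Derivation.leibniz, map_add, derivative_C, derivative_X, smul_eq_mul, h2]
    at hU hU' hC ⊢
  set U := besselSeries α
  set U1 := d⁄dX ℂ U
  set U2 := d⁄dX ℂ U1
  set U3 := d⁄dX ℂ U2
  linear_combination (2 * X * U) * hU' + (6 * X * U1 + (8 * C α - 2) * U) * hU
    + (2 * X ^ 2 * U * U1 + 2 * C α * X * U ^ 2) * hC

theorem coeff_besselSeries_sq_odd (α : ℂ) (k : ℕ) :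
    coeff (2 * k + 1) (besselSeries α ^ 2) = 0 := by
  rw [sq, coeff_mul]
  refine Finset.sum_eq_zero fun ⟨i, j⟩ hij => ?_
  rw [Finset.HasAntidiagonal.mem_antidiagonal] at hij
  rcases Nat.even_or_odd' i with ⟨l, rfl | rfl⟩
  · obtain ⟨m, rfl⟩ : ∃ m, j = 2 * m + 1 := ⟨k - l, by simp only at hij; omega⟩
    rw [coeff_besselSeries_odd, mul_zero]
  · rw [coeff_besselSeries_odd, zero_mul]

/-- Preece's identity, coefficientwise. -/
theorem coeff_besselSeries_sq_even {α : ℂ} (h : NotNonposInt (2 * α))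
    (h' : NotNonposInt (α + 1 / 2)) (k : ℕ) :
    coeff (2 * k) (besselSeries α ^ 2) =
      poch α k / (poch (α + 1 / 2) k * poch (2 * α) k) / 4 ^ k / k.factorial := by
  induction k with
  | zero => simp [sq, besselSeries, besselCoeff, poch_zero]
  | succ k ih =>
    have key := congrArg (coeff (2 * k + 1)) (besselSeries_sq_ode h)
    rw [show (6 * C α : ℂ⟦X⟧) = C (6 * α) by rw [map_mul, map_ofNat],
      show (8 * C α ^ 2 - 2 * C α : ℂ⟦X⟧) = C (8 * α ^ 2 - 2 * α) by
        rw [map_sub, map_mul, map_mul, map_pow, map_ofNat, map_ofNat],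
      show (2 * C α : ℂ⟦X⟧) = C (2 * α) by rw [map_mul, map_ofNat]] at key
    simp only [map_add, coeff_C_mul, coeff_succ_X_mul, coeff_X_mul_derivative, coeff_derivative,
      ih] at key
    have h1 := h.add_natCast_ne_zero k
    have h1' := h'.add_natCast_ne_zero k
    have := poch_ne_zero h k
    have := poch_ne_zero h' k
    have h2 : (k + 1 : ℂ) ≠ 0 := by norm_cast
    have : (k.factorial : ℂ) ≠ 0 := by exact_mod_cast k.factorial_ne_zero
    rw [poch_succ, poch_succ, poch_succ, Nat.factorial_succ,
      show 2 * (k + 1) = 2 * k + 1 + 1 by ring]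
    refine mul_left_cancel₀ (mul_ne_zero (mul_ne_zero h1 h1') h2) ?_
    push_cast at key ⊢
    trans (α + k) / 4 *
      (poch α k / (poch (α + 1 / 2) k * poch (2 * α) k) / 4 ^ k / k.factorial)
    · linear_combination key / 8
    · generalize poch (α + 1 / 2) k = p at *
      generalize α + 1 / 2 + (k : ℂ) = q at *
      generalize poch (2 * α) k = r at *
      generalize 2 * α + (k : ℂ) = t at *
      field_simp
      ring

end PowerSeries

open PowerSeries

theorem rathie_identity_1_13 (x α : ℂ)
    (h1 : NotNonposInt (2*α)) (h2 : NotNonposInt (2*α - 1))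
    (h3 : NotNonposInt (α + 1/2)) :
    pFq [α] [2*α] x * pFq [α] [2*α - 1] x =
      Complex.exp x * (pFq [α] [α + 1/2, 2*α - 1] (x^2/4)
        + x / (2 * (2*α - 1)) * pFq [α] [α + 1/2, 2*α] (x^2/4)) := by
  have hb : 2 * α - 1 ≠ 0 := by simpa using h2 0
  set c : ℂ := (2 * α - 1)⁻¹ with hc
  set F : ℂ⟦X⟧ := expHalf * besselSeries α with hF
  set W : ℂ⟦X⟧ := besselSeries α ^ 2 with hW
  have hFc (n : ℕ) : coeff n F = poch α n / poch (2 * α) n / n.factorial :=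
    coeff_expHalf_mul_besselSeries h1 n
  have hFx (n : ℕ) : coeff n F * x ^ n = poch α n / poch (2 * α) n * x ^ n / n.factorial := by
    rw [hFc]; ring
  have hGx (n : ℕ) : coeff n (F + C c * (X * d⁄dX ℂ F)) * x ^ n =
      poch α n / poch (2 * α - 1) n * x ^ n / n.factorial := by
    rw [map_add, coeff_C_mul, coeff_X_mul_derivative, hFc, hc]
    have := poch_ne_zero h1 n
    have := poch_ne_zero h2 n
    have : (n.factorial : ℂ) ≠ 0 := by exact_mod_cast n.factorial_ne_zero
    field_simp
    linear_combination poch α n * x ^ n * poch_sub_one_mul (2 * α) n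
  have hExp (n : ℕ) : coeff n (exp ℂ) * x ^ n = x ^ n / n.factorial := by
    rw [coeff_exp]
    simp
    ring
  have hTeven (k : ℕ) : coeff (2 * k) (W + C (c / 2) * (X * W + X * d⁄dX ℂ W)) * x ^ (2 * k) =
      poch α k / (poch (α + 1 / 2) k * poch (2 * α - 1) k) * (x ^ 2 / 4) ^ k / k.factorial := by
    have hXW : coeff (2 * k) (X * W) = 0 := by
      cases k with
      | zero => simp
      | succ k => exact (coeff_succ_X_mul (2 * k + 1) W).trans (coeff_besselSeries_sq_odd α k)
    rw [map_add, coeff_C_mul, map_add, hXW, coeff_X_mul_derivative,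
      coeff_besselSeries_sq_even h1 h3, hc, pow_mul, div_pow]
    have := poch_ne_zero h1 k
    have := poch_ne_zero h2 k
    have := poch_ne_zero h3 k
    have : (k.factorial : ℂ) ≠ 0 := by exact_mod_cast k.factorial_ne_zero
    generalize poch (α + 1 / 2) k = p at *
    push_cast
    field_simp
    linear_combination 2 * poch α k * x ^ (2 * k) * poch_sub_one_mul (2 * α) k
  have hTodd (k : ℕ) :
      coeff (2 * k + 1) (W + C (c / 2) * (X * W + X * d⁄dX ℂ W)) * x ^ (2 * k + 1) =
      x / (2 * (2 * α - 1)) * (poch α k / (poch (α + 1 / 2) k * poch (2 * α) k) *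
        (x ^ 2 / 4) ^ k / k.factorial) := by
    rw [map_add, coeff_C_mul, map_add, coeff_succ_X_mul, coeff_X_mul_derivative,
      coeff_besselSeries_sq_odd, coeff_besselSeries_sq_even h1 h3, hc, pow_succ, pow_mul, div_pow]
    field_simp
    ring
  have hprod : F * (F + C c * (X * d⁄dX ℂ F)) =
      exp ℂ * (W + C (c / 2) * (X * W + X * d⁄dX ℂ W)) := by
    rw [← expHalf_sq, hF, hW, div_eq_mul_inv, RingHom.map_mul]
    simp only [sq, Derivation.leibniz, derivative_expHalf, smul_eq_mul]
    linear_combination (-(C c * X * expHalf ^ 2 * besselSeries α * d⁄dX ℂ (besselSeries α))) *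
      two_mul_C_half
  have sF := summable_norm_one_one α x h1
  have sG := summable_norm_one_one α x h2
  have sA := summable_norm_one_two α (x ^ 2 / 4) h3 h2
  have sB := summable_norm_one_two α (x ^ 2 / 4) h3 h1
  have sT : Summable fun n =>
      ‖coeff n (W + C (c / 2) * (X * W + X * d⁄dX ℂ W)) * x ^ n‖ := by
    refine (HasSum.even_add_odd (Summable.hasSum ?_) (Summable.hasSum ?_)).summable
    · simpa only [hTeven] using sA
    · simpa only [hTodd, norm_mul (x / (2 * (2 * α - 1)))] using sB.mul_left _
  have hT : ∑' n, coeff n (W + C (c / 2) * (X * W + X * d⁄dX ℂ W)) * x ^ n =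
      pFq [α] [α + 1/2, 2*α - 1] (x^2/4) +
        x / (2 * (2*α - 1)) * pFq [α] [α + 1/2, 2*α] (x^2/4) := by
    rw [pFq_one_two, pFq_one_two, ← tsum_mul_left]
    refine (HasSum.even_add_odd ?_ ?_).tsum_eq
    · simpa only [hTeven] using sA.of_norm.hasSum
    · simpa only [hTodd] using (sB.of_norm.mul_left _).hasSum
  have hE : ∑' n, coeff n (exp ℂ) * x ^ n = Complex.exp x := by
    simp only [hExp]
    rw [Complex.exp_eq_exp_ℂ, NormedSpace.exp_eq_tsum_div]
  rw [← hT, ← hE, pFq_one_one, pFq_one_one]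
  simp only [← hFx, ← hGx] at sF sG ⊢
  rw [tsum_coeff_mul sF sG, tsum_coeff_mul _ sT, hprod]
  simpa only [hExp] using NormedSpace.norm_expSeries_div_summable x
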